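/- arXiv:2107.14469 — 2 statements merged into one kernel-verified Lean document; each statement's English description precedes it below -/
import Mathlib

section
/- Let n = 1 and let f : ℝ×ℝᵐ → ℝ, g : ℝ×ℝᵐ → ℝᵖ be three times continuously differentiable, and assume inf-compactness at x̄. Suppose S(x̄) = {ȳ} (unique global minimizer) and ȳ is a nondegenerate critical point of L(x̄) (conditions ND1–ND3). Then there exists a neighborhood U of (x̄,ȳ) such that Σ_gc ∩ U = M ∩ U; that is, every generalized critical point y of L(x) with (x,y) ∈ U is a global minimizer of L(x), and conversely. In particular, for all (x,y) ∈ Σ_gc ∩ U one has dist(y, S(x)) = 0, so the uniform weak sharp minimum over g.c. points holds at (x̄,ȳ) with constant L = 0. -/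
open scoped RealInnerProductSpace
open Topology

noncomputable section

/-- The lower-level feasible set `Y(x) = {y : g(x,y) ≤ 0}`. -/
def Yset {m p : ℕ} (g : ℝ × EuclideanSpace ℝ (Fin m) → Fin p → ℝ)
    (x : ℝ) : Set (EuclideanSpace ℝ (Fin m)) :=
  {y | ∀ j, g (x, y) j ≤ 0}

/-- The lower-level solution set `S(x)`. -/
def Sset {m p : ℕ} (f : ℝ × EuclideanSpace ℝ (Fin m) → ℝ)
    (g : ℝ × EuclideanSpace ℝ (Fin m) → Fin p → ℝ)
    (x : ℝ) : Set (EuclideanSpace ℝ (Fin m)) :=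
  {y | y ∈ Yset g x ∧ ∀ y' ∈ Yset g x, f (x, y) ≤ f (x, y')}

/-- The graph `M = {(x,y) : y ∈ S(x)}` of the lower-level solution map. -/
def Mset {m p : ℕ} (f : ℝ × EuclideanSpace ℝ (Fin m) → ℝ)
    (g : ℝ × EuclideanSpace ℝ (Fin m) → Fin p → ℝ) :
    Set (ℝ × EuclideanSpace ℝ (Fin m)) :=
  {z | z.2 ∈ Sset f g z.1}

/-- The partial gradient `∇_y f (x,y)` (upper-level variable one-dimensional). -/
def gradY {m : ℕ} (f : ℝ × EuclideanSpace ℝ (Fin m) → ℝ)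
    (x : ℝ) (y : EuclideanSpace ℝ (Fin m)) : EuclideanSpace ℝ (Fin m) :=
  gradient (fun y' => f (x, y')) y

/-- The partial gradient `∇_y g_j (x,y)`. -/
def gradYg {m p : ℕ} (g : ℝ × EuclideanSpace ℝ (Fin m) → Fin p → ℝ)
    (x : ℝ) (y : EuclideanSpace ℝ (Fin m)) (j : Fin p) : EuclideanSpace ℝ (Fin m) :=
  gradient (fun y' => g (x, y') j) y

/-- The lower-level Lagrangian `f + ūᵀ g`. -/
def Lag {m p : ℕ} (f : ℝ × EuclideanSpace ℝ (Fin m) → ℝ)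
    (g : ℝ × EuclideanSpace ℝ (Fin m) → Fin p → ℝ) (u : Fin p → ℝ) :
    ℝ × EuclideanSpace ℝ (Fin m) → ℝ :=
  fun z => f z + ∑ j, u j * g z j

/-- The Hessian block `∇²_{yy}(f + ūᵀg)(x̄,ȳ)` as a continuous linear map. -/
def LagYY {m p : ℕ} (f : ℝ × EuclideanSpace ℝ (Fin m) → ℝ)
    (g : ℝ × EuclideanSpace ℝ (Fin m) → Fin p → ℝ) (u : Fin p → ℝ)
    (x : ℝ) (y : EuclideanSpace ℝ (Fin m)) :
    EuclideanSpace ℝ (Fin m) →L[ℝ] EuclideanSpace ℝ (Fin m) :=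
  fderiv ℝ (fun y' => gradY (Lag f g u) x y') y

/-- `y` is a generalized critical (g.c.) point of `L(x)`. -/
def gcPoint {m p : ℕ} (f : ℝ × EuclideanSpace ℝ (Fin m) → ℝ)
    (g : ℝ × EuclideanSpace ℝ (Fin m) → Fin p → ℝ)
    (x : ℝ) (y : EuclideanSpace ℝ (Fin m)) : Prop :=
  (∀ j, g (x, y) j ≤ 0) ∧
    ∃ (u₀ : ℝ) (u : Fin p → ℝ), (u₀, u) ≠ 0 ∧
      (∀ j, g (x, y) j ≠ 0 → u j = 0) ∧
      u₀ • gradY f x y + ∑ j, u j • gradYg g x y j = 0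

/-- `Σ_gc`, the set of pairs `(x,y)` such that `y` is a g.c. point of `L(x)`. -/
def SigmaGC {m p : ℕ} (f : ℝ × EuclideanSpace ℝ (Fin m) → ℝ)
    (g : ℝ × EuclideanSpace ℝ (Fin m) → Fin p → ℝ) :
    Set (ℝ × EuclideanSpace ℝ (Fin m)) :=
  {z | gcPoint f g z.1 z.2}

lemma sum_supp {p : ℕ} {E : Type*} [AddCommMonoid E] (P : Fin p → Prop) [DecidablePred P]
    (F : Fin p → E) (h : ∀ j, ¬ P j → F j = 0) : ∑ j, F j = ∑ i : {j // P j}, F i.1 := by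
  rw [← Finset.sum_filter_of_ne (p := P) (fun j _ hj => by by_contra hc; exact hj (h j hc))]
  exact Finset.sum_subtype _ (by simp) F

lemma gradY_eq {m : ℕ} {f : ℝ × EuclideanSpace ℝ (Fin m) → ℝ} (hf : ContDiff ℝ 3 f)
    (x : ℝ) (y : EuclideanSpace ℝ (Fin m)) :
    gradY f x y = (InnerProductSpace.toDual ℝ (EuclideanSpace ℝ (Fin m))).symm
      ((fderiv ℝ f (x, y)).comp (ContinuousLinearMap.inr ℝ ℝ (EuclideanSpace ℝ (Fin m)))) := by
  have h1 : HasFDerivAt f (fderiv ℝ f (x, y)) (x, y) :=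
    (hf.differentiable (by norm_num) (x, y)).hasFDerivAt
  have h2 : HasFDerivAt (fun y' : EuclideanSpace ℝ (Fin m) => (x, y'))
      (ContinuousLinearMap.inr ℝ ℝ (EuclideanSpace ℝ (Fin m))) y := hasFDerivAt_prodMk_right x y
  have h3 := h1.comp y h2
  unfold gradY gradient
  congr 1
  exact h3.fderiv

lemma gradY_hasStrict {m : ℕ} {f : ℝ × EuclideanSpace ℝ (Fin m) → ℝ} (hf : ContDiff ℝ 3 f)
    (x : ℝ) (y : EuclideanSpace ℝ (Fin m)) :
    HasStrictFDerivAt (fun y' => f (x, y'))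
      (InnerProductSpace.toDual ℝ (EuclideanSpace ℝ (Fin m)) (gradY f x y)) y := by
  have h : ContDiff ℝ 3 (fun y' => f (x, y')) := hf.comp (by fun_prop)
  have h2 := (h.contDiffAt (x := y)).hasStrictFDerivAt (by norm_num)
  unfold gradY
  rwa [toDual_gradient]

lemma gradY_contDiff {m : ℕ} {f : ℝ × EuclideanSpace ℝ (Fin m) → ℝ} (hf : ContDiff ℝ 3 f) :
    ContDiff ℝ 2 (fun z : ℝ × EuclideanSpace ℝ (Fin m) => gradY f z.1 z.2) := by
  simp_rw [gradY_eq hf]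
  have h1 : ContDiff ℝ 2 (fun z : ℝ × EuclideanSpace ℝ (Fin m) => fderiv ℝ f z) :=
    hf.fderiv_right (by norm_num)
  refine (InnerProductSpace.toDual ℝ (EuclideanSpace ℝ (Fin m))).symm.contDiff.comp ?_
  exact h1.clm_comp contDiff_const

lemma inner_gradY {m : ℕ} {f : ℝ × EuclideanSpace ℝ (Fin m) → ℝ} (hf : ContDiff ℝ 3 f)
    (x : ℝ) (y w : EuclideanSpace ℝ (Fin m)) :
    ⟪gradY f x y, w⟫ = fderiv ℝ f (x, y) (0, w) := by
  rw [gradY_eq hf, InnerProductSpace.toDual_symm_apply]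
  simp

lemma gradY_Lag {m p : ℕ} {f : ℝ × EuclideanSpace ℝ (Fin m) → ℝ}
    {g : ℝ × EuclideanSpace ℝ (Fin m) → Fin p → ℝ}
    (hf : ContDiff ℝ 3 f) (hg : ContDiff ℝ 3 g) (u : Fin p → ℝ)
    (x : ℝ) (y : EuclideanSpace ℝ (Fin m)) :
    gradY (Lag f g u) x y = gradY f x y + ∑ j, u j • gradYg g x y j := by
  have hgj : ∀ j, ContDiff ℝ 3 (fun z => g z j) := fun j => contDiff_pi.1 hg j
  have h := (gradY_hasStrict hf x y).hasFDerivAt.add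
    (HasFDerivAt.fun_sum (u := Finset.univ)
      (fun j _ => ((gradY_hasStrict (hgj j) x y).hasFDerivAt.const_mul (u j))))
  unfold gradY gradient
  have h2 : HasFDerivAt (fun y' => Lag f g u (x, y')) _ y := h
  rw [h2.fderiv]
  simp only [map_add, map_sum, map_smul, LinearIsometryEquiv.symm_apply_apply]
  rfl

lemma LagYY_apply {m p : ℕ} {f : ℝ × EuclideanSpace ℝ (Fin m) → ℝ}
    {g : ℝ × EuclideanSpace ℝ (Fin m) → Fin p → ℝ}
    (hf : ContDiff ℝ 3 f) (hg : ContDiff ℝ 3 g) (u : Fin p → ℝ)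
    (x : ℝ) (y w : EuclideanSpace ℝ (Fin m)) :
    LagYY f g u x y w =
      fderiv ℝ (fun z : ℝ × EuclideanSpace ℝ (Fin m) => gradY f z.1 z.2) (x, y) (0, w)
      + ∑ j, u j • fderiv ℝ (fun z : ℝ × EuclideanSpace ℝ (Fin m) => gradYg g z.1 z.2 j)
          (x, y) (0, w) := by
  have hgj : ∀ j, ContDiff ℝ 3 (fun z => g z j) := fun j => contDiff_pi.1 hg j
  have h2 : HasFDerivAt (fun y' : EuclideanSpace ℝ (Fin m) => (x, y'))
      (ContinuousLinearMap.inr ℝ ℝ (EuclideanSpace ℝ (Fin m))) y := hasFDerivAt_prodMk_right x y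
  have hF := ((gradY_contDiff hf).differentiable (by norm_num) (x, y)).hasFDerivAt.comp y h2
  have hG := fun j =>
    ((gradY_contDiff (hgj j)).differentiable (by norm_num) (x, y)).hasFDerivAt.comp y h2
  have h := hF.add (HasFDerivAt.fun_sum (u := Finset.univ) (fun j _ => (hG j).const_smul (u j)))
  have h3 := h.congr_of_eventuallyEq (f₁ := fun y' => gradY (Lag f g u) x y')
    (Filter.Eventually.of_forall fun y' => gradY_Lag hf hg u x y')
  unfold LagYY
  rw [h3.fderiv]
  simp
  rfl

/-- Global minimizers are g.c. points. -/
lemma Mset_sub {m p : ℕ} {f : ℝ × EuclideanSpace ℝ (Fin m) → ℝ}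
    {g : ℝ × EuclideanSpace ℝ (Fin m) → Fin p → ℝ}
    (hf : ContDiff ℝ 3 f) (hg : ContDiff ℝ 3 g) : Mset f g ⊆ SigmaGC f g := by
  classical
  rintro ⟨x, y⟩ ⟨hy, hmin⟩
  have hgj : ∀ j, ContDiff ℝ 3 (fun z => g z j) := fun j => contDiff_pi.1 hg j
  refine ⟨hy, ?_⟩
  have hex : IsLocalExtrOn (fun y' => f (x, y'))
      {y' | ∀ i : {j : Fin p // g (x, y) j = 0}, g (x, y') i.1 = g (x, y) i.1} y := by
    left
    have hin : ∀ j, g (x, y) j ≠ 0 → ∀ᶠ y' in 𝓝 y, g (x, y') j < 0 := by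
      intro j hj
      have hc : Continuous (fun y' => g (x, y') j) := (hgj j).continuous.comp (by fun_prop)
      exact hc.continuousAt.eventually_lt continuousAt_const (lt_of_le_of_ne (hy j) hj)
    have hin' : ∀ᶠ y' in 𝓝 y, ∀ j, g (x, y) j ≠ 0 → g (x, y') j < 0 := by
      rw [Filter.eventually_all]
      intro j
      by_cases hj : g (x, y) j = 0
      · simp [hj]
      · filter_upwards [hin j hj] with a ha _ using ha
    filter_upwards [nhdsWithin_le_nhds hin', self_mem_nhdsWithin] with y' h1 h2
    refine hmin y' fun j => ?_
    by_cases hj : g (x, y) j = 0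
    · exact (h2 ⟨j, hj⟩).trans hj |>.le
    · exact (h1 j hj).le
  obtain ⟨Λ, Λ₀, hne, hsum⟩ := hex.exists_multipliers_of_hasStrictFDerivAt
    (fun i => gradY_hasStrict (hgj i.1) x y) (gradY_hasStrict hf x y)
  refine ⟨Λ₀, fun j => if h : g (x, y) j = 0 then Λ ⟨j, h⟩ else 0, ?_, ?_, ?_⟩
  · intro h0
    apply hne
    rw [Prod.mk_eq_zero] at h0 ⊢
    refine ⟨?_, h0.1⟩
    funext i
    have := congrFun h0.2 i.1
    simpa [i.2] using this
  · intro j hj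
    simp [show ¬ g (x, y) j = 0 from hj]
  · apply (InnerProductSpace.toDual ℝ (EuclideanSpace ℝ (Fin m))).injective
    rw [map_zero, ← hsum, map_add, map_sum, map_smul, add_comm]
    congr 1
    rw [sum_supp (fun j => g (x, y) j = 0)]
    · refine Finset.sum_congr rfl fun i _ => ?_
      simp only [dif_pos i.2, map_smul]
      rfl
    · intro j hj
      simp [hj]

/-- Existence of nearby minimizers. -/
lemma exists_min_near {m p : ℕ} {f : ℝ × EuclideanSpace ℝ (Fin m) → ℝ}
    {g : ℝ × EuclideanSpace ℝ (Fin m) → Fin p → ℝ}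
    (hf : Continuous f)
    (xbar : ℝ) (ybar : EuclideanSpace ℝ (Fin m))
    (hIC : ∀ c : ℝ, IsCompact {z : ℝ × EuclideanSpace ℝ (Fin m) |
      |z.1 - xbar| ≤ 1 ∧ f z ≤ c ∧ ∀ j, g z j ≤ 0})
    (hS : Sset f g xbar = {ybar})
    (hfeas : ∀ N ∈ 𝓝 (xbar, ybar), ∀ᶠ x in 𝓝 xbar, ∃ y ∈ Yset g x, (x, y) ∈ N)
    (N : Set (ℝ × EuclideanSpace ℝ (Fin m))) (hN : IsOpen N) (hmem : (xbar, ybar) ∈ N) :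
    ∀ᶠ x in 𝓝 xbar, ∃ y ∈ Sset f g x, (x, y) ∈ N := by
  set c := f (xbar, ybar) + 1 with hc
  have hK := hIC c
  set K := {z : ℝ × EuclideanSpace ℝ (Fin m) |
      |z.1 - xbar| ≤ 1 ∧ f z ≤ c ∧ ∀ j, g z j ≤ 0} with hKdef
  have hyb : ybar ∈ Sset f g xbar := by rw [hS]; rfl
  have hpos : ∀ z ∈ K \ N, 0 < |z.1 - xbar| + max (f z - f (xbar, ybar)) 0 := by
    rintro ⟨x, y⟩ ⟨⟨h1, h2, h3⟩, h4⟩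
    by_contra hcon
    have ha := abs_nonneg (x - xbar)
    have hb := le_max_right (f (x, y) - f (xbar, ybar)) 0
    have hb' := le_max_left (f (x, y) - f (xbar, ybar)) 0
    simp only [not_lt] at hcon
    have hx : |x - xbar| = 0 := by linarith
    have hx' : x = xbar := by linarith [abs_eq_zero.1 hx]
    subst hx'
    have hle : f (x, y) ≤ f (x, ybar) := by linarith
    have hyS : y ∈ Sset f g x := ⟨h3, fun y' hy' => hle.trans (hyb.2 y' hy')⟩
    rw [hS] at hyS
    rw [Set.mem_singleton_iff.1 hyS] at h4
    exact h4 hmem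
  obtain ⟨μ, hμ, hμK⟩ := (hK.diff hN).exists_forall_le' (by fun_prop) hpos
  have hN' : N ∩ {z | f z < f (xbar, ybar) + min (μ / 2) 1} ∈ 𝓝 (xbar, ybar) := by
    refine Filter.inter_mem (hN.mem_nhds hmem) ?_
    refine (isOpen_lt hf continuous_const).mem_nhds ?_
    have : 0 < min (μ / 2) 1 := lt_min (by linarith) one_pos
    simpa using this
  have hx : ∀ᶠ x in 𝓝 xbar, |x - xbar| < min (μ / 2) 1 := by
    have : 0 < min (μ / 2) 1 := lt_min (by linarith) one_pos
    filter_upwards [Metric.ball_mem_nhds xbar this] with x hx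
    simpa [Real.dist_eq] using hx
  filter_upwards [hx, hfeas _ hN'] with x hx ⟨y0, hy0, hy0N, hy0f⟩
  have hx1 := hx.trans_le (min_le_left _ _)
  have hx2 := hx.trans_le (min_le_right _ _)
  have hm1 := min_le_left (μ / 2) 1
  have hm2 := min_le_right (μ / 2) 1
  simp only [Set.mem_ofPred_eq] at hy0f
  have hKx : IsCompact (K ∩ {z | z.1 = x}) :=
    hK.inter_right (isClosed_eq continuous_fst continuous_const)
  obtain ⟨⟨x', y⟩, ⟨hzK, hzx⟩, hzmin⟩ := hKx.exists_isMinOn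
    ⟨(x, y0), ⟨hx2.le, by linarith, hy0⟩, rfl⟩ hf.continuousOn
  simp only [Set.mem_ofPred_eq] at hzx
  subst hzx
  have hfy : f (x', y) ≤ f (x', y0) := hzmin ⟨⟨hx2.le, by linarith, hy0⟩, rfl⟩
  refine ⟨y, ⟨hzK.2.2, fun y' hy' => ?_⟩, ?_⟩
  · by_cases h : f (x', y') ≤ c
    · exact hzmin ⟨⟨hx2.le, h, hy'⟩, rfl⟩
    · linarith [hzK.2.1]
  · by_contra hnot
    have h5 := hμK _ ⟨hzK, hnot⟩
    simp only at h5
    have h6 : max (f (x', y) - f (xbar, ybar)) 0 ≤ μ / 2 := max_le (by linarith) (by linarith)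
    linarith
/-- Uniform lower bound for a continuous family of linear maps, injective at one point. -/
lemma lower_bound {Z V W : Type*} [TopologicalSpace Z] [NormedAddCommGroup V] [NormedSpace ℝ V]
    [FiniteDimensional ℝ V] [NormedAddCommGroup W] [NormedSpace ℝ W]
    (B : Z → V →L[ℝ] W) (z₀ : Z) (hB : ContinuousAt B z₀) (hinj : Function.Injective (B z₀)) :
    ∃ c > 0, ∀ᶠ z in 𝓝 z₀, ∀ u, c * ‖u‖ ≤ ‖B z u‖ := by
  obtain ⟨K, hK, hKB⟩ := LinearMap.exists_antilipschitzWith (B z₀ : V →ₗ[ℝ] W)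
    (LinearMap.ker_eq_bot.2 hinj)
  have hK' : (0 : ℝ) < K := hK
  have h1 : ∀ u, ‖u‖ ≤ K * ‖B z₀ u‖ := fun u => by
    have := hKB.le_mul_dist u 0
    simpa using this
  refine ⟨1 / (2 * K), by positivity, ?_⟩
  have h2 : ∀ᶠ z in 𝓝 z₀, dist (B z) (B z₀) < 1 / (2 * K) :=
    hB.eventually (Metric.ball_mem_nhds _ (by positivity))
  filter_upwards [h2] with z hz u
  rw [dist_eq_norm] at hz
  have h3 : ‖(B z - B z₀) u‖ ≤ 1 / (2 * K) * ‖u‖ :=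
    ((B z - B z₀).le_opNorm u).trans (by gcongr)
  have h4 : ‖B z₀ u‖ ≤ ‖B z u‖ + ‖(B z - B z₀) u‖ := by
    have : B z₀ u = B z u - (B z - B z₀) u := by simp
    rw [this]
    exact norm_sub_le _ _
  have h5 : 1 / K * ‖u‖ ≤ ‖B z₀ u‖ := by
    rw [one_div, inv_mul_le_iff₀ hK']
    exact h1 u
  have h6 : 1 / (K : ℝ) = 1 / (2 * K) + 1 / (2 * K) := by field_simp; norm_num
  rw [h6, add_mul] at h5
  linarith

/-- Near the reference point, g.c. points have normalized multipliers close to `ubar`. -/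
lemma mult_near {m p : ℕ} {f : ℝ × EuclideanSpace ℝ (Fin m) → ℝ}
    {g : ℝ × EuclideanSpace ℝ (Fin m) → Fin p → ℝ}
    (hf : ContDiff ℝ 3 f) (hg : ContDiff ℝ 3 g)
    (xbar : ℝ) (ybar : EuclideanSpace ℝ (Fin m))
    (ubar : Fin p → ℝ)
    (husupp : ∀ j, g (xbar, ybar) j ≠ 0 → ubar j = 0)
    (hLICQ : LinearIndependent ℝ
      (fun j : {j : Fin p // g (xbar, ybar) j = 0} => gradYg g xbar ybar j.1))
    (hstat : gradY f xbar ybar + ∑ j, ubar j • gradYg g xbar ybar j = 0)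
    (A : Set (Fin p → ℝ)) (hA : A ∈ 𝓝 ubar) :
    ∀ᶠ z in 𝓝 (xbar, ybar), z ∈ SigmaGC f g → ∃ u ∈ A,
      (∀ j, g z j ≠ 0 → u j = 0) ∧ (∀ j, g (xbar, ybar) j ≠ 0 → u j = 0) ∧
      gradY f z.1 z.2 + ∑ j, u j • gradYg g z.1 z.2 j = 0 := by
  classical
  have hgj : ∀ j, ContDiff ℝ 3 (fun z => g z j) := fun j => contDiff_pi.1 hg j
  have hcf : Continuous (fun z : ℝ × EuclideanSpace ℝ (Fin m) => gradY f z.1 z.2) :=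
    (gradY_contDiff hf).continuous
  have hcg : ∀ j, Continuous (fun z : ℝ × EuclideanSpace ℝ (Fin m) => gradYg g z.1 z.2 j) :=
    fun j => (gradY_contDiff (hgj j)).continuous
  let J := {j : Fin p // g (xbar, ybar) j = 0}
  let B : ℝ × EuclideanSpace ℝ (Fin m) → (J → ℝ) →L[ℝ] EuclideanSpace ℝ (Fin m) := fun z =>
    ∑ j : J, ContinuousLinearMap.smulRightL ℝ (J → ℝ) (EuclideanSpace ℝ (Fin m))
      (ContinuousLinearMap.proj j : (J → ℝ) →L[ℝ] ℝ) (gradYg g z.1 z.2 j.1)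
  have hBapp : ∀ z u, B z u = ∑ j : J, u j • gradYg g z.1 z.2 j.1 := by
    intro z u
    simp [B]
  have hBc : Continuous B := by
    refine continuous_finsetSum _ fun j _ => ?_
    exact (ContinuousLinearMap.continuous _).comp (hcg j.1)
  have hBinj : Function.Injective (B (xbar, ybar)) := by
    rw [injective_iff_map_eq_zero]
    intro u hu
    rw [hBapp] at hu
    funext j
    exact Fintype.linearIndependent_iff.1 hLICQ u hu j
  obtain ⟨c, hc, hcB⟩ := lower_bound B (xbar, ybar) hBc.continuousAt hBinj
  have hBs : ∀ z (u : Fin p → ℝ), (∀ j, g (xbar, ybar) j ≠ 0 → u j = 0) →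
      ∑ j, u j • gradYg g z.1 z.2 j = B z (fun j : J => u j.1) := by
    intro z u hu
    rw [hBapp]
    exact sum_supp (fun j => g (xbar, ybar) j = 0) _ (fun j hj => by simp [hu j hj])
  -- residual
  have hr : Continuous (fun z : ℝ × EuclideanSpace ℝ (Fin m) =>
      gradY f z.1 z.2 + ∑ j, ubar j • gradYg g z.1 z.2 j) :=
    hcf.add (continuous_finsetSum _ fun j _ => by have := hcg j; fun_prop)
  obtain ⟨ε, hε, hεA⟩ := Metric.mem_nhds_iff.1 hA
  have hr' : ∀ᶠ z in 𝓝 (xbar, ybar),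
      ‖gradY f z.1 z.2 + ∑ j, ubar j • gradYg g z.1 z.2 j‖ < c * (ε / 2) := by
    have h0 : ‖gradY f xbar ybar + ∑ j, ubar j • gradYg g xbar ybar j‖ < c * (ε / 2) := by
      rw [hstat, norm_zero]; positivity
    exact hr.norm.continuousAt.eventually_lt continuousAt_const h0
  have hin : ∀ᶠ z in 𝓝 (xbar, ybar), ∀ j, g (xbar, ybar) j ≠ 0 → g z j ≠ 0 := by
    rw [Filter.eventually_all]
    intro j
    by_cases hj : g (xbar, ybar) j = 0
    · simp [hj]
    · filter_upwards [(hgj j).continuous.continuousAt.eventually_ne hj] with a ha _ using ha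
  filter_upwards [hcB, hr', hin] with z hz1 hz2 hz3
  rintro ⟨-, u₀, u, hne, hsupp, hsum⟩
  have hsupp' : ∀ j, g (xbar, ybar) j ≠ 0 → u j = 0 := fun j hj => hsupp j (hz3 j hj)
  have hu₀ : u₀ ≠ 0 := by
    rintro rfl
    apply hne
    rw [zero_smul, zero_add, hBs z u hsupp'] at hsum
    have h1 := hz1 (fun j : J => u j.1)
    rw [hsum, norm_zero] at h1
    have h2 : ‖(fun j : J => u j.1)‖ = 0 := by
      have := norm_nonneg (fun j : J => u j.1)
      nlinarith
    rw [norm_eq_zero] at h2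
    rw [Prod.mk_eq_zero]
    refine ⟨rfl, ?_⟩
    funext j
    by_cases hj : g (xbar, ybar) j = 0
    · exact congrFun h2 ⟨j, hj⟩
    · exact hsupp' j hj
  have hsum' : gradY f z.1 z.2 + ∑ j, (u₀⁻¹ * u j) • gradYg g z.1 z.2 j = 0 := by
    have := congrArg (fun v => u₀⁻¹ • v) hsum
    simpa [smul_add, smul_smul, hu₀, Finset.smul_sum] using this
  refine ⟨fun j => u₀⁻¹ * u j, ?_, fun j hj => by simp [hsupp j hj],
    fun j hj => by simp [hsupp' j hj], hsum'⟩
  apply hεA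
  have hd : ∀ j, g (xbar, ybar) j ≠ 0 → (ubar - fun j => u₀⁻¹ * u j) j = 0 := fun j hj => by
    simp [hsupp' j hj, husupp j hj]
  have h1 := hBs z _ hd
  have h2 : ∑ j, (ubar - fun j => u₀⁻¹ * u j) j • gradYg g z.1 z.2 j
      = gradY f z.1 z.2 + ∑ j, ubar j • gradYg g z.1 z.2 j := by
    simp only [Pi.sub_apply, sub_smul, Finset.sum_sub_distrib]
    rw [eq_neg_of_add_eq_zero_right hsum']
    abel
  have h3 := hz1 (fun j : J => (ubar - fun j => u₀⁻¹ * u j) j.1)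
  rw [← h1, h2] at h3
  have h4 := lt_of_mul_lt_mul_left (h3.trans_lt hz2) hc.le
  rw [Metric.mem_ball, dist_comm, dist_eq_norm]
  refine lt_of_le_of_lt ?_ (half_lt_self hε)
  rw [pi_norm_le_iff_of_nonneg (by positivity)]
  intro j
  by_cases hj : g (xbar, ybar) j = 0
  · exact (norm_le_pi_norm (fun j : J => (ubar - fun j => u₀⁻¹ * u j) j.1) ⟨j, hj⟩).trans h4.le
  · rw [hd j hj, norm_zero]; positivity

open Classical in
/-- The KKT map. -/
def kktMap {m p : ℕ} (f : ℝ × EuclideanSpace ℝ (Fin m) → ℝ)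
    (g : ℝ × EuclideanSpace ℝ (Fin m) → Fin p → ℝ) (zbar : ℝ × EuclideanSpace ℝ (Fin m))
    (v : (ℝ × EuclideanSpace ℝ (Fin m)) × (Fin p → ℝ)) :
    (ℝ × EuclideanSpace ℝ (Fin m)) × (Fin p → ℝ) :=
  ((v.1.1, gradY f v.1.1 v.1.2 + ∑ j, v.2 j • gradYg g v.1.1 v.1.2 j),
    fun j => if g zbar j = 0 then g v.1 j else v.2 j)

lemma kkt_strict {m p : ℕ} {f : ℝ × EuclideanSpace ℝ (Fin m) → ℝ}
    {g : ℝ × EuclideanSpace ℝ (Fin m) → Fin p → ℝ}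
    (hf : ContDiff ℝ 3 f) (hg : ContDiff ℝ 3 g)
    (xbar : ℝ) (ybar : EuclideanSpace ℝ (Fin m))
    (ubar : Fin p → ℝ)
    (hLICQ : LinearIndependent ℝ
      (fun j : {j : Fin p // g (xbar, ybar) j = 0} => gradYg g xbar ybar j.1))
    (hSOC : ∀ w : EuclideanSpace ℝ (Fin m),
      (∀ j, g (xbar, ybar) j = 0 → ⟪gradYg g xbar ybar j, w⟫ = 0) →
      (∀ v : EuclideanSpace ℝ (Fin m),
        (∀ j, g (xbar, ybar) j = 0 → ⟪gradYg g xbar ybar j, v⟫ = 0) →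
        ⟪LagYY f g ubar xbar ybar w, v⟫ = 0) →
      w = 0) :
    ∃ e : ((ℝ × EuclideanSpace ℝ (Fin m)) × (Fin p → ℝ)) ≃L[ℝ]
        ((ℝ × EuclideanSpace ℝ (Fin m)) × (Fin p → ℝ)),
      HasStrictFDerivAt (kktMap f g (xbar, ybar))
        (e : ((ℝ × EuclideanSpace ℝ (Fin m)) × (Fin p → ℝ)) →L[ℝ]
        ((ℝ × EuclideanSpace ℝ (Fin m)) × (Fin p → ℝ))) ((xbar, ybar), ubar) := by
  classical
  have hgj : ∀ j, ContDiff ℝ 3 (fun z => g z j) := fun j => contDiff_pi.1 hg j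
  let V := (ℝ × EuclideanSpace ℝ (Fin m)) × (Fin p → ℝ)
  let a : V := ((xbar, ybar), ubar)
  have hfst : HasStrictFDerivAt (fun v : V => v.1)
    (ContinuousLinearMap.fst ℝ (ℝ × EuclideanSpace ℝ (Fin m)) (Fin p → ℝ)) a :=
    hasStrictFDerivAt_fst
  have hcoord : ∀ j, HasStrictFDerivAt (fun v : V => v.2 j)
    ((ContinuousLinearMap.proj j : (Fin p → ℝ) →L[ℝ] ℝ).comp
      (ContinuousLinearMap.snd ℝ (ℝ × EuclideanSpace ℝ (Fin m)) (Fin p → ℝ))) a := fun j =>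
    ContinuousLinearMap.hasStrictFDerivAt ((ContinuousLinearMap.proj j : (Fin p → ℝ) →L[ℝ] ℝ).comp
      (ContinuousLinearMap.snd ℝ (ℝ × EuclideanSpace ℝ (Fin m)) (Fin p → ℝ)))
  have hcomp : ∀ {W : Type} [NormedAddCommGroup W] [NormedSpace ℝ W]
      (H : ℝ × EuclideanSpace ℝ (Fin m) → W), ContDiff ℝ 2 H →
      HasStrictFDerivAt (fun v : V => H v.1) ((fderiv ℝ H (xbar, ybar)).comp
        (ContinuousLinearMap.fst ℝ (ℝ × EuclideanSpace ℝ (Fin m)) (Fin p → ℝ))) a := by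
    intro W _ _ H hH
    exact HasStrictFDerivAt.comp (g := H) a
      ((hH.contDiffAt (x := (xbar, ybar))).hasStrictFDerivAt (by norm_num)) hfst
  have hF := hcomp _ (gradY_contDiff hf)
  have hG : ∀ j, HasStrictFDerivAt (fun v : V => gradYg g v.1.1 v.1.2 j)
      ((fderiv ℝ (fun z : ℝ × EuclideanSpace ℝ (Fin m) => gradYg g z.1 z.2 j) (xbar, ybar)).comp
        (ContinuousLinearMap.fst ℝ (ℝ × EuclideanSpace ℝ (Fin m)) (Fin p → ℝ))) a :=
    fun j => hcomp _ (gradY_contDiff (hgj j))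
  have hg' := fun j => hcomp _ ((hgj j).of_le (by norm_num))
  have hlast : ∀ j, HasStrictFDerivAt
      (fun v : V => if g (xbar, ybar) j = 0 then g v.1 j else v.2 j)
      (if g (xbar, ybar) j = 0 then (fderiv ℝ (fun z => g z j) (xbar, ybar)).comp
        (ContinuousLinearMap.fst ℝ (ℝ × EuclideanSpace ℝ (Fin m)) (Fin p → ℝ))
        else ((ContinuousLinearMap.proj j : (Fin p → ℝ) →L[ℝ] ℝ).comp
      (ContinuousLinearMap.snd ℝ (ℝ × EuclideanSpace ℝ (Fin m)) (Fin p → ℝ)))) a := by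
    intro j
    by_cases hj : g (xbar, ybar) j = 0
    · simp only [hj, if_true]; exact hg' j
    · simp only [hj, if_false]; exact hcoord j
  have h1 : HasStrictFDerivAt (fun v : V => v.1.1) _ a := hasStrictFDerivAt_fst.comp a hfst
  have hall := (h1.prodMk (hF.add (HasStrictFDerivAt.fun_sum (u := Finset.univ)
    (fun j _ => (hcoord j).smul (hG j))))).prodMk (hasStrictFDerivAt_pi.2 hlast)
  generalize hD : (ContinuousLinearMap.prod _ _ : V →L[ℝ] V) = D at hall
  have hDinj : Function.Injective D := by
    rw [injective_iff_map_eq_zero]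
    rintro ⟨⟨t, w⟩, μ⟩ h0
    rw [← hD] at h0
    simp only [ContinuousLinearMap.prod_apply, Prod.mk_eq_zero] at h0
    obtain ⟨⟨ht, hL⟩, hJ⟩ := h0
    have ht' : t = 0 := ht
    subst ht'
    have hL' : LagYY f g ubar xbar ybar w + ∑ j, μ j • gradYg g xbar ybar j = 0 := by
      rw [LagYY_apply hf hg, ← hL]
      simp [Finset.sum_add_distrib, a, add_assoc]
      rfl
    have hw : ∀ j, g (xbar, ybar) j = 0 → ⟪gradYg g xbar ybar j, w⟫ = 0 := by
      intro j hj
      have := congrFun hJ j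
      simp only [ContinuousLinearMap.coe_pi', hj, if_true] at this
      exact (inner_gradY (hgj j) xbar ybar w).trans this
    have hμ : ∀ j, g (xbar, ybar) j ≠ 0 → μ j = 0 := by
      intro j hj
      have := congrFun hJ j
      simp only [ContinuousLinearMap.coe_pi', hj, if_false] at this
      exact this
    have hw0 : w = 0 := by
      refine hSOC w hw fun v hv => ?_
      have h2 := congrArg (fun q => ⟪q, v⟫) hL'
      simp only [inner_add_left, sum_inner, inner_smul_left, inner_zero_left] at h2
      rw [Finset.sum_eq_zero, add_zero] at h2
      · exact h2
      · intro j _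
        by_cases hj : g (xbar, ybar) j = 0
        · simp [hv j hj]
        · simp [hμ j hj]
    subst hw0
    rw [map_zero, zero_add, sum_supp (fun j => g (xbar, ybar) j = 0) _
      (fun j hj => by simp [hμ j hj])] at hL'
    have h3 := Fintype.linearIndependent_iff.1 hLICQ (fun j => μ j.1) hL'
    have : μ = 0 := by
      funext j
      by_cases hj : g (xbar, ybar) j = 0
      · exact h3 ⟨j, hj⟩
      · exact hμ j hj
    rw [this]
    rfl
  refine ⟨(LinearEquiv.ofInjectiveEndo (D : V →ₗ[ℝ] V) hDinj).toContinuousLinearEquiv, ?_⟩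
  have hDe : (((LinearEquiv.ofInjectiveEndo (D : V →ₗ[ℝ] V) hDinj).toContinuousLinearEquiv :
      V ≃L[ℝ] V) : V →L[ℝ] V) = D := by
    refine ContinuousLinearMap.ext fun v => ?_
    rfl
  rw [hDe]
  exact hall

theorem statement11 {m p : ℕ}
    (f : ℝ × EuclideanSpace ℝ (Fin m) → ℝ)
    (g : ℝ × EuclideanSpace ℝ (Fin m) → Fin p → ℝ)
    (hf : ContDiff ℝ 3 f) (hg : ContDiff ℝ 3 g)
    (xbar : ℝ) (ybar : EuclideanSpace ℝ (Fin m))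
    -- inf-compactness at x̄
    (hIC : ∀ c : ℝ, IsCompact {z : ℝ × EuclideanSpace ℝ (Fin m) |
      |z.1 - xbar| ≤ 1 ∧ f z ≤ c ∧ ∀ j, g z j ≤ 0})
    -- ȳ is the unique global minimizer of L(x̄)
    (hS : Sset f g xbar = {ybar})
    (ubar : Fin p → ℝ)
    (husupp : ∀ j, g (xbar, ybar) j ≠ 0 → ubar j = 0)
    -- ND1 (LICQ) and the multiplier rule
    (hLICQ : LinearIndependent ℝ
      (fun j : {j : Fin p // g (xbar, ybar) j = 0} => gradYg g xbar ybar j.1))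
    (hstat : gradY f xbar ybar + ∑ j, ubar j • gradYg g xbar ybar j = 0)
    -- ND2 (strict complementarity)
    (hSC : ∀ j, g (xbar, ybar) j = 0 → ubar j ≠ 0)
    -- ND3 (second-order condition)
    (hSOC : ∀ w : EuclideanSpace ℝ (Fin m),
      (∀ j, g (xbar, ybar) j = 0 → ⟪gradYg g xbar ybar j, w⟫ = 0) →
      (∀ v : EuclideanSpace ℝ (Fin m),
        (∀ j, g (xbar, ybar) j = 0 → ⟪gradYg g xbar ybar j, v⟫ = 0) →
        ⟪LagYY f g ubar xbar ybar w, v⟫ = 0) →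
      w = 0) :
    ∃ U ∈ 𝓝 (xbar, ybar),
      SigmaGC f g ∩ U = Mset f g ∩ U ∧
      ∀ z ∈ SigmaGC f g ∩ U, Metric.infDist z.2 (Sset f g z.1) = 0 := by
  classical
  have hgj : ∀ j, ContDiff ℝ 3 (fun z => g z j) := fun j => contDiff_pi.1 hg j
  have hyb : ybar ∈ Sset f g xbar := by rw [hS]; rfl
  obtain ⟨e, he⟩ := kkt_strict hf hg xbar ybar ubar hLICQ hSOC
  have hbar : kktMap f g (xbar, ybar) ((xbar, ybar), ubar) = ((xbar, 0), 0) := by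
    unfold kktMap
    simp only [Prod.mk.injEq, true_and]
    refine ⟨hstat, ?_⟩
    funext j
    by_cases hj : g (xbar, ybar) j = 0
    · simp [hj]
    · simp [hj, husupp j hj]
  -- feasible points near the reference point
  have hfeas : ∀ N ∈ 𝓝 (xbar, ybar), ∀ᶠ x in 𝓝 xbar, ∃ y ∈ Yset g x, (x, y) ∈ N := by
    intro N hN
    have hin : ∀ᶠ z in 𝓝 (xbar, ybar), ∀ j, g (xbar, ybar) j ≠ 0 → g z j < 0 := by
      rw [Filter.eventually_all]
      intro j
      by_cases hj : g (xbar, ybar) j = 0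
      · simp [hj]
      · filter_upwards [(hgj j).continuous.continuousAt.eventually_lt continuousAt_const
          (lt_of_le_of_ne (hyb.1 j) hj)] with a ha _ using ha
    have hW : ∀ᶠ v in 𝓝 ((xbar, ybar), ubar), v.1 ∈ N ∧
        ∀ j, g (xbar, ybar) j ≠ 0 → g v.1 j < 0 :=
      (continuous_fst.tendsto ((xbar, ybar), ubar)).eventually
        (p := fun z => z ∈ N ∧ ∀ j, g (xbar, ybar) j ≠ 0 → g z j < 0)
        (Filter.Eventually.and (Filter.eventually_mem_set.2 hN) hin)
    have himg := Filter.image_mem_map (m := kktMap f g (xbar, ybar)) hW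
    rw [he.map_nhds_eq_of_equiv, hbar] at himg
    have hcont : ContinuousAt
        (fun x : ℝ => (((x, 0), 0) : (ℝ × EuclideanSpace ℝ (Fin m)) × (Fin p → ℝ))) xbar := by
      fun_prop
    filter_upwards [hcont.eventually himg] with x hx
    obtain ⟨⟨⟨x', y⟩, u⟩, ⟨hvN, hvg⟩, hv⟩ := hx
    unfold kktMap at hv
    simp only [Prod.mk.injEq] at hv
    obtain ⟨⟨rfl, -⟩, hv2⟩ := hv
    refine ⟨y, fun j => ?_, hvN⟩
    by_cases hj : g (xbar, ybar) j = 0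
    · have := congrFun hv2 j
      simp only [hj, if_true] at this
      exact this.le
    · exact (hvg j hj).le
  -- local uniqueness of g.c. points
  have hinj := he.eventually_left_inverse
  have hnz : ∀ᶠ u in 𝓝 ubar, ∀ j, g (xbar, ybar) j = 0 → u j ≠ 0 := by
    rw [Filter.eventually_all]
    intro j
    by_cases hj : g (xbar, ybar) j = 0
    · filter_upwards [(continuous_apply j).continuousAt.eventually_ne (hSC j hj)] with a ha _ using ha
    · simp [hj]
  rw [nhds_prod_eq] at hinj
  obtain ⟨P, hP, Q, hQ, hPQ⟩ := Filter.eventually_prod_iff.1 hinj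
  have hmult := mult_near hf hg xbar ybar ubar husupp hLICQ hstat _ (hQ.and hnz)
  have hgood : ∀ᶠ z in 𝓝 (xbar, ybar), P z ∧ (z ∈ SigmaGC f g → ∃ u, Q u ∧
      kktMap f g (xbar, ybar) (z, u) = ((z.1, 0), 0)) := by
    filter_upwards [hP, hmult] with z h1 h2
    refine ⟨h1, fun hz => ?_⟩
    obtain ⟨u, ⟨hu1, hu2⟩, hu3, hu4, hu5⟩ := h2 hz
    refine ⟨u, hu1, ?_⟩
    unfold kktMap
    simp only [Prod.mk.injEq, true_and]
    refine ⟨hu5, ?_⟩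
    funext j
    by_cases hj : g (xbar, ybar) j = 0
    · simp only [hj, if_true, Pi.zero_apply]
      by_contra hne
      exact hu2 j hj (hu3 j hne)
    · simp [hj, hu4 j hj]
  obtain ⟨N, hNsub, hNo, hNm⟩ := eventually_nhds_iff.1 hgood
  have huniq : ∀ z ∈ N, ∀ z' ∈ N, z ∈ SigmaGC f g → z' ∈ SigmaGC f g → z.1 = z'.1 → z = z' := by
    intro z hz z' hz' h1 h2 h3
    obtain ⟨u, hu, hk⟩ := (hNsub z hz).2 h1
    obtain ⟨u', hu', hk'⟩ := (hNsub z' hz').2 h2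
    have e1 := hPQ (hNsub z hz).1 hu
    have e2 := hPQ (hNsub z' hz').1 hu'
    rw [hk] at e1
    rw [hk', ← h3, e1] at e2
    exact congrArg Prod.fst e2
  have hmin := exists_min_near hf.continuous xbar ybar hIC hS hfeas N hNo hNm
  have key : ∀ z ∈ N ∩ {z | ∃ y ∈ Sset f g z.1, (z.1, y) ∈ N}, z ∈ SigmaGC f g → z ∈ Mset f g := by
    rintro z ⟨hzN, y, hy, hyN⟩ hz
    have h1 : (z.1, y) ∈ Mset f g := hy
    have h2 := huniq z hzN (z.1, y) hyN hz (Mset_sub hf hg h1) rfl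
    rw [h2]
    exact h1
  refine ⟨N ∩ {z | ∃ y ∈ Sset f g z.1, (z.1, y) ∈ N},
    Filter.inter_mem (hNo.mem_nhds hNm) ((continuous_fst.tendsto (xbar, ybar)).eventually hmin), ?_, ?_⟩
  · ext z
    exact ⟨fun h => ⟨key z h.2 h.1, h.2⟩, fun h => ⟨Mset_sub hf hg h.1, h.2⟩⟩
  · rintro z ⟨hz, hzU⟩
    exact Metric.infDist_zero_of_mem (key z hzU hz)
end
end

section
/- Let n = 1 and let f : ℝ×ℝᵐ → ℝ, g : ℝ×ℝᵐ → ℝᵖ be continuously differentiable, and assume inf-compactness at x̄. Suppose S(x̄) = {ȳ₁, ȳ₂} with ȳ₁ ≠ ȳ₂ and there are continuously differentiable maps y₁, y₂ defined on a neighborhood N of x̄ with y_k(x̄) = ȳ_k and y_k(x) ∈ Y(x) for all x ∈ N, together with neighborhoods U_k of (x̄,ȳ_k) such that every (x,y) ∈ U_k with y a generalized critical point of L(x) satisfies y = y_k(x). Assume further α := (d/dx)[f(x,y₂(x)) − f(x,y₁(x))] evaluated at x = x̄ is nonzero. Then the partial error bound over Σ_FJ holds at (x̄,ȳ₁): the map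 K_FJ(v) := {(x,y) ∈ Σ_FJ : f(x,y) − V(x) ≤ v} is calm at (0,(x̄,ȳ₁)), i.e. there exist ε > 0, a neighborhood U of (x̄,ȳ₁) and a constant L > 0 with dist((x,y), K_FJ(0)) ≤ L·|v| for all |v| < ε and all (x,y) ∈ U ∩ K_FJ(v). -/
open scoped RealInnerProductSpace
open Topology

noncomputable section

/-- The value function `V(x) = inf {f(x,y) : y ∈ Y(x)}`. -/
def Vval {m p : ℕ} (f : ℝ × EuclideanSpace ℝ (Fin m) → ℝ)
    (g : ℝ × EuclideanSpace ℝ (Fin m) → Fin p → ℝ) (x : ℝ) : ℝ :=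
  sInf ((fun y => f (x, y)) '' Yset g x)

/-- `y` is a Fritz John point of `L(x)`. -/
def FJPoint {m p : ℕ} (f : ℝ × EuclideanSpace ℝ (Fin m) → ℝ)
    (g : ℝ × EuclideanSpace ℝ (Fin m) → Fin p → ℝ)
    (x : ℝ) (y : EuclideanSpace ℝ (Fin m)) : Prop :=
  (∀ j, g (x, y) j ≤ 0) ∧
    ∃ (u₀ : ℝ) (u : Fin p → ℝ), 0 ≤ u₀ ∧ (∀ j, 0 ≤ u j) ∧ (u₀, u) ≠ 0 ∧
      (∀ j, g (x, y) j ≠ 0 → u j = 0) ∧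
      u₀ • gradY f x y + ∑ j, u j • gradYg g x y j = 0

/-- `Σ_FJ`, the set of pairs `(x,y)` such that `y` is a FJ point of `L(x)`. -/
def SigmaFJ {m p : ℕ} (f : ℝ × EuclideanSpace ℝ (Fin m) → ℝ)
    (g : ℝ × EuclideanSpace ℝ (Fin m) → Fin p → ℝ) :
    Set (ℝ × EuclideanSpace ℝ (Fin m)) :=
  {z | FJPoint f g z.1 z.2}

/-- The partially perturbed map `K_FJ(v) = {(x,y) ∈ Σ_FJ : f(x,y) - V(x) ≤ v}`. -/
def KFJ {m p : ℕ} (f : ℝ × EuclideanSpace ℝ (Fin m) → ℝ)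
    (g : ℝ × EuclideanSpace ℝ (Fin m) → Fin p → ℝ) (v : ℝ) :
    Set (ℝ × EuclideanSpace ℝ (Fin m)) :=
  {z ∈ SigmaFJ f g | f z - Vval f g z.1 ≤ v}

theorem fj_aux {E : Type*} [NormedAddCommGroup E] [InnerProductSpace ℝ E] [CompleteSpace E]
    {p : ℕ} (F : E → ℝ) (G : Fin p → E → ℝ) (y : E)
    (hF : DifferentiableAt ℝ F y) (hG : ∀ j, DifferentiableAt ℝ (G j) y)
    (hy : ∀ j, G j y ≤ 0) (hmin : ∀ y', (∀ j, G j y' ≤ 0) → F y ≤ F y') :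
    ∃ (u₀ : ℝ) (u : Fin p → ℝ), 0 ≤ u₀ ∧ (∀ j, 0 ≤ u j) ∧ (u₀, u) ≠ 0 ∧
      (∀ j, G j y ≠ 0 → u j = 0) ∧
      u₀ • gradient F y + ∑ j, u j • gradient (G j) y = 0 := by
  classical
  let T : (Option (Fin p) → ℝ) →ₗ[ℝ] E :=
    { toFun := fun w => w none • gradient F y + ∑ j, w (some j) • gradient (G j) y
      map_add' := by
        intro a b
        simp only [Pi.add_apply, add_smul, Finset.sum_add_distrib]
        abel
      map_smul' := by
        intro c a
        simp only [Pi.smul_apply, smul_eq_mul, mul_smul, smul_add, Finset.smul_sum,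
          RingHom.id_apply] }
  have hT : ∀ w, T w = w none • gradient F y + ∑ j, w (some j) • gradient (G j) y := fun _ => rfl
  let K : Set (Option (Fin p) → ℝ) :=
    stdSimplex ℝ (Option (Fin p)) ∩ {w | ∀ j, G j y ≠ 0 → w (some j) = 0}
  have hK2 : IsClosed {w : Option (Fin p) → ℝ | ∀ j, G j y ≠ 0 → w (some j) = 0} := by
    simp only [Set.ofPred_forall]
    refine isClosed_iInter fun j => isClosed_iInter fun _ => ?_
    exact isClosed_eq (continuous_apply _) continuous_const
  have hKc : IsCompact K := (isCompact_stdSimplex ℝ _).inter_right hK2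
  have hKconv : Convex ℝ K := by
    refine (convex_stdSimplex ℝ _).inter ?_
    intro a ha b hb s t _ _ _ j hj
    simp [ha j hj, hb j hj]
  have hTc : Continuous T := T.continuous_of_finiteDimensional
  by_cases h0 : (0 : E) ∈ T '' K
  · obtain ⟨w, ⟨hw, hw2⟩, hw0⟩ := h0
    refine ⟨w none, fun j => w (some j), hw.1 _, fun j => hw.1 _, ?_, hw2, hw0⟩
    intro h
    have h1 : w none = 0 := congrArg Prod.fst h
    have h2 : (fun j => w (some j)) = 0 := congrArg Prod.snd h
    have h3 := hw.2
    rw [Fintype.sum_option, h1] at h3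
    simp [fun j => congrFun h2 j] at h3
  · exfalso
    obtain ⟨ℓ, u, hu0, hu⟩ := geometric_hahn_banach_point_closed
      (hKconv.linear_image T) (hKc.image hTc).isClosed h0
    rw [map_zero] at hu0
    let d : E := (InnerProductSpace.toDual ℝ E).symm ℓ
    have hd : ∀ a, ℓ a = inner ℝ d a := fun a => by simp [d]
    have key : ∀ (H : E → ℝ), DifferentiableAt ℝ H y → 0 < ℓ (gradient H y) →
        ∀ᶠ t in 𝓝[>] (0 : ℝ), H (y - t • d) < H y := by
      intro H hH hpos
      have h1 : HasFDerivAt H (InnerProductSpace.toDual ℝ E (gradient H y)) y :=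
        hH.hasGradientAt.hasFDerivAt
      have h2 : HasDerivAt (fun t : ℝ => y - t • d) (-d) 0 := by
        simpa using ((hasDerivAt_id (0 : ℝ)).smul_const d).const_sub y
      have h3 : HasDerivAt (fun t : ℝ => H (y - t • d)) (- ℓ (gradient H y)) 0 := by
        have h1' : HasFDerivAt H (InnerProductSpace.toDual ℝ E (gradient H y))
          (y - (0 : ℝ) • d) := by simpa using h1
        have := h1'.comp_hasDerivAt (0 : ℝ) h2
        simp only [InnerProductSpace.toDual_apply_apply, inner_neg_right] at this
        rw [hd, real_inner_comm]
        exact this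
      have h4 := (hasDerivAt_iff_tendsto_slope.1 h3).eventually
        (gt_mem_nhds (show -ℓ (gradient H y) < 0 by linarith))
      have h5 := h4.filter_mono (nhdsWithin_mono 0 (fun t (ht : (0 : ℝ) < t) => ne_of_gt ht))
      filter_upwards [h5, self_mem_nhdsWithin] with t ht ht0
      have ht0' : (0 : ℝ) < t := ht0
      rw [slope_def_field] at ht
      simp only [zero_smul, sub_zero] at ht
      rw [div_lt_iff₀ ht0'] at ht
      linarith
    have hFpos : 0 < ℓ (gradient F y) := by
      have := hu _ ⟨Pi.single none 1, ⟨single_mem_stdSimplex ℝ _, fun j _ => by simp⟩, rfl⟩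
      rw [hT] at this
      simp at this
      linarith
    have hGpos : ∀ j, G j y = 0 → 0 < ℓ (gradient (G j) y) := by
      intro j hj
      have := hu _ ⟨Pi.single (some j) 1, ⟨single_mem_stdSimplex ℝ _, fun i hi => by
        have : i ≠ j := fun h => hi (h ▸ hj)
        simp [Pi.single_apply, this]⟩, rfl⟩
      rw [hT] at this
      simp [Pi.single_apply] at this
      linarith
    have hGev : ∀ᶠ t in 𝓝[>] (0 : ℝ), ∀ j, G j (y - t • d) ≤ 0 := by
      rw [Filter.eventually_all]
      intro j
      by_cases hj : G j y = 0
      · filter_upwards [key (G j) (hG j) (hGpos j hj)] with t ht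
        linarith
      · have hlt : G j y < 0 := lt_of_le_of_ne (hy j) hj
        have hc : ContinuousAt (fun t : ℝ => G j (y - t • d)) 0 := by
          apply ContinuousAt.comp (g := G j)
          · simpa using (hG j).continuousAt
          · fun_prop
        have := hc.eventually (gt_mem_nhds (show G j (y - (0 : ℝ) • d) < 0 by simpa using hlt))
        filter_upwards [this.filter_mono nhdsWithin_le_nhds] with t ht
        exact ht.le
    obtain ⟨t, ht1, ht2⟩ := (hGev.and (key F hF hFpos)).exists
    exact absurd (hmin _ ht1) (not_le.2 ht2)

theorem statement13 {m p : ℕ}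
    (f : ℝ × EuclideanSpace ℝ (Fin m) → ℝ)
    (g : ℝ × EuclideanSpace ℝ (Fin m) → Fin p → ℝ)
    (hf : ContDiff ℝ 1 f) (hg : ContDiff ℝ 1 g)
    (xbar : ℝ)
    -- inf-compactness at x̄
    (hIC : ∀ c : ℝ, IsCompact {z : ℝ × EuclideanSpace ℝ (Fin m) |
      |z.1 - xbar| ≤ 1 ∧ f z ≤ c ∧ ∀ j, g z j ≤ 0})
    (ybar1 ybar2 : EuclideanSpace ℝ (Fin m)) (hne : ybar1 ≠ ybar2)
    (hS : Sset f g xbar = {ybar1, ybar2})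
    (N : Set ℝ) (hN : N ∈ 𝓝 xbar)
    (y1 y2 : ℝ → EuclideanSpace ℝ (Fin m))
    (hy1c : ContDiffOn ℝ 1 y1 N) (hy2c : ContDiffOn ℝ 1 y2 N)
    (hy1bar : y1 xbar = ybar1) (hy2bar : y2 xbar = ybar2)
    (hy1Y : ∀ x ∈ N, y1 x ∈ Yset g x) (hy2Y : ∀ x ∈ N, y2 x ∈ Yset g x)
    (U1 : Set (ℝ × EuclideanSpace ℝ (Fin m))) (hU1 : U1 ∈ 𝓝 (xbar, ybar1))
    (U2 : Set (ℝ × EuclideanSpace ℝ (Fin m))) (hU2 : U2 ∈ 𝓝 (xbar, ybar2))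
    (hloc1 : ∀ z ∈ U1, gcPoint f g z.1 z.2 → z.2 = y1 z.1)
    (hloc2 : ∀ z ∈ U2, gcPoint f g z.1 z.2 → z.2 = y2 z.1)
    -- α ≠ 0
    (hα : deriv (fun x => f (x, y2 x) - f (x, y1 x)) xbar ≠ 0) :
    -- the partial error bound over Σ_FJ holds at (x̄,ȳ₁) with constant L > 0
    ∃ ε > (0 : ℝ), ∃ U ∈ 𝓝 (xbar, ybar1), ∃ L > (0 : ℝ),
      ∀ v : ℝ, |v| < ε → ∀ z ∈ U, z ∈ KFJ f g v →
        Metric.infDist z (KFJ f g 0) ≤ L * |v| := by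
  classical
  -- minimizers are FJ points
  have hFJ : ∀ x y, y ∈ Sset f g x → FJPoint f g x y := by
    intro x y hy
    refine ⟨hy.1, ?_⟩
    have hfd : Differentiable ℝ f := hf.differentiable one_ne_zero
    have hgd : Differentiable ℝ g := hg.differentiable one_ne_zero
    refine fj_aux (fun y' => f (x, y')) (fun j y' => g (x, y') j) y ?_ ?_ hy.1 hy.2
    · fun_prop
    · intro j
      have : Differentiable ℝ (fun y' => g (x, y')) := by fun_prop
      exact differentiableAt_pi.1 (this y) j
  have hgc : ∀ x y, FJPoint f g x y → gcPoint f g x y := by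
    rintro x y ⟨h, u₀, u, -, -, h1, h2, h3⟩
    exact ⟨h, u₀, u, h1, h2, h3⟩
  have hV : ∀ x y, y ∈ Sset f g x → Vval f g x = f (x, y) := by
    intro x y hy
    apply IsLeast.csInf_eq
    exact ⟨⟨y, hy.1, rfl⟩, by rintro _ ⟨y', hy', rfl⟩; exact hy.2 y' hy'⟩
  have hfc : Continuous f := hf.continuous
  have hs1 : ybar1 ∈ Sset f g xbar := by rw [hS]; simp
  have hs2 : ybar2 ∈ Sset f g xbar := by rw [hS]; simp
  have hy1d : DifferentiableAt ℝ y1 xbar := (hy1c.contDiffAt hN).differentiableAt one_ne_zero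
  have hy1cont := hy1d.continuousAt
  have hf1 : ContinuousAt (fun x => f (x, y1 x)) xbar :=
    hfc.continuousAt.comp (continuousAt_id.prodMk hy1cont)
  set Kc := {z : ℝ × EuclideanSpace ℝ (Fin m) |
      |z.1 - xbar| ≤ 1 ∧ f z ≤ f (xbar, ybar1) + 1 ∧ ∀ j, g z j ≤ 0} with hKc
  have hKcc : IsCompact Kc := hIC _
  have hK' : IsCompact (Kc \ (interior U1 ∪ interior U2)) :=
    hKcc.diff (isOpen_interior.union isOpen_interior)
  have hloc : ∀ᶠ x in 𝓝 xbar, ∀ z ∈ Kc \ (interior U1 ∪ interior U2),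
      ¬ (z.1 = x ∧ f z ≤ f (x, y1 x)) := by
    apply hK'.eventually_forall_of_forall_eventually
    rintro z ⟨hz, hzU⟩
    by_cases hzx : z.1 = xbar
    · have hzS : f (xbar, y1 xbar) < f z := by
        by_contra hcon
        push Not at hcon
        rw [hy1bar] at hcon
        have hzeq : z = (xbar, z.2) := by rw [← hzx]
        have : z.2 ∈ Sset f g xbar := by
          refine ⟨fun j => ?_, fun y' hy' => ?_⟩
          · rw [← hzeq]; exact hz.2.2 j
          · rw [← hzeq]; exact hcon.trans (hs1.2 y' hy')
        rw [hS] at this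
        apply hzU
        rcases this with h | h
        · left; rw [hzeq, h]; exact mem_interior_iff_mem_nhds.2 hU1
        · right; rw [hzeq, Set.mem_singleton_iff.1 h]; exact mem_interior_iff_mem_nhds.2 hU2
      have hc1 : ContinuousAt (fun q : ℝ × (ℝ × EuclideanSpace ℝ (Fin m)) => f (q.1, y1 q.1))
          (xbar, z) := ContinuousAt.comp (f := Prod.fst) (g := fun x => f (x, y1 x)) hf1
            continuousAt_fst
      have hc2 : ContinuousAt (fun q : ℝ × (ℝ × EuclideanSpace ℝ (Fin m)) => f q.2)
          (xbar, z) := (hfc.comp continuous_snd).continuousAt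
      filter_upwards [hc1.eventually_lt hc2 hzS] with q hq h
      exact absurd h.2 (not_le.2 hq)
    · have hc1 : ContinuousAt (fun q : ℝ × (ℝ × EuclideanSpace ℝ (Fin m)) => q.2.1)
          (xbar, z) := by fun_prop
      have hc2 : ContinuousAt (fun q : ℝ × (ℝ × EuclideanSpace ℝ (Fin m)) => q.1)
          (xbar, z) := by fun_prop
      filter_upwards [ContinuousAt.eventually_ne (hc1.sub hc2) (sub_ne_zero.2 hzx)] with q hq h
      exact hq (sub_eq_zero.2 h.1)
  have hmin : ∀ᶠ x in 𝓝 xbar, ∃ y ∈ Sset f g x, y = y1 x ∨ y = y2 x := by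
    have hb : f (xbar, y1 xbar) < f (xbar, ybar1) + 1 := by rw [hy1bar]; linarith
    filter_upwards [hloc, hN, hf1.eventually (gt_mem_nhds hb),
      Metric.closedBall_mem_nhds xbar one_pos] with x hx hxN hxf hxb
    have hxb' : |x - xbar| ≤ 1 := by simpa [Real.dist_eq] using hxb
    have hcomp : IsCompact (Kc ∩ {z | z.1 = x}) :=
      hKcc.inter_right (isClosed_eq continuous_fst continuous_const)
    have hmem1 : (x, y1 x) ∈ Kc ∩ {z | z.1 = x} := ⟨⟨hxb', hxf.le, hy1Y x hxN⟩, rfl⟩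
    obtain ⟨z, ⟨hz, hzx⟩, hzmin⟩ := hcomp.exists_isMinOn ⟨_, hmem1⟩ hfc.continuousOn
    have hzx' : z.1 = x := hzx
    have hzeq : z = (x, z.2) := by rw [← hzx']
    have hzS : z.2 ∈ Sset f g x := by
      refine ⟨fun j => ?_, fun y' hy' => ?_⟩
      · rw [← hzeq]; exact hz.2.2 j
      · rw [← hzeq]
        by_cases hle : f (x, y') ≤ f (xbar, ybar1) + 1
        · exact hzmin ⟨⟨hxb', hle, hy'⟩, rfl⟩
        · exact hz.2.1.trans (not_le.1 hle).le
    refine ⟨z.2, hzS, ?_⟩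
    have hgcz : gcPoint f g z.1 z.2 := by rw [hzx']; exact hgc _ _ (hFJ _ _ hzS)
    by_cases hzU : z ∈ interior U1 ∪ interior U2
    · rcases hzU with h | h
      · left; rw [← hzx']; exact hloc1 z (interior_subset h) hgcz
      · right; rw [← hzx']; exact hloc2 z (interior_subset h) hgcz
    · exact absurd ⟨hzx', hzmin hmem1⟩ (hx z ⟨hz, hzU⟩)
  set φ := fun x => f (x, y2 x) - f (x, y1 x) with hφ
  set α := deriv φ xbar with hαdef
  have hαpos : 0 < |α| := abs_pos.2 hα
  have hφ0 : φ xbar = 0 := by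
    simp only [hφ, hy1bar, hy2bar]
    linarith [hs1.2 _ hs2.1, hs2.2 _ hs1.1]
  have hφd : HasDerivAt φ α xbar := (differentiableAt_of_deriv_ne_zero hα).hasDerivAt
  have hφe : ∀ᶠ x in 𝓝 xbar, |α| / 2 * |x - xbar| ≤ |φ x| := by
    have := (hasDerivAt_iff_isLittleO.1 hφd).def (half_pos hαpos)
    filter_upwards [this] with x hx
    simp only [hφ0, sub_zero, smul_eq_mul, Real.norm_eq_abs] at hx
    have h1 : |(x - xbar) * α| ≤ |φ x| + |φ x - (x - xbar) * α| := by
      have := abs_sub (φ x) (φ x - (x - xbar) * α)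
      simpa using this
    rw [abs_mul] at h1
    nlinarith
  obtain ⟨C, hC⟩ := hy1d.isBigO_sub.bound
  have hall := hmin.and (hφe.and hC)
  refine ⟨1, one_pos, U1 ∩ Prod.fst ⁻¹' {x | (∃ y ∈ Sset f g x, y = y1 x ∨ y = y2 x) ∧
    (|α| / 2 * |x - xbar| ≤ |φ x|) ∧ ‖y1 x - y1 xbar‖ ≤ C * ‖x - xbar‖},
    Filter.inter_mem hU1 (continuous_fst.continuousAt.preimage_mem_nhds hall),
    (1 + |C|) * (2 / |α|), by positivity, ?_⟩
  rintro v - z ⟨hzU, ⟨y, hyS, hy⟩, hzφ, hzC⟩ ⟨hzFJ, hzv⟩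
  have hLnn : 0 ≤ (1 + |C|) * (2 / |α|) * |v| := by positivity
  have hz2 : z.2 = y1 z.1 := hloc1 z hzU (hgc _ _ hzFJ)
  have hzeq : z = (z.1, y1 z.1) := by rw [← hz2]
  have hcase0 : f z ≤ Vval f g z.1 → Metric.infDist z (KFJ f g 0) ≤
      (1 + |C|) * (2 / |α|) * |v| := by
    intro h
    have : z ∈ KFJ f g 0 := ⟨hzFJ, by linarith⟩
    rw [Metric.infDist_zero_of_mem this]
    exact hLnn
  rcases hy with hy | hy
  · apply hcase0
    rw [hV _ _ hyS, hy, ← hzeq]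
  · by_cases hle : f z ≤ Vval f g z.1
    · exact hcase0 hle
    · push Not at hle
      have hφz : φ z.1 = Vval f g z.1 - f z := by
        rw [hV _ _ hyS, hy]
        simp only [hφ]
        rw [← hzeq]
      have h1 : |φ z.1| ≤ |v| := by
        rw [hφz, abs_of_neg (by linarith)]
        linarith [le_abs_self v]
      have h2 : |z.1 - xbar| ≤ 2 / |α| * |v| := by
        rw [div_mul_eq_mul_div, le_div_iff₀ hαpos]
        linarith
      have hmem : (xbar, ybar1) ∈ KFJ f g 0 :=
        ⟨hFJ _ _ hs1, by simp [hV _ _ hs1]⟩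
      refine (Metric.infDist_le_dist_of_mem hmem).trans ?_
      have h3 : dist z (xbar, ybar1) ≤ (1 + |C|) * |z.1 - xbar| := by
        rw [Prod.dist_eq]
        apply max_le
        · simp only [Real.dist_eq]
          nlinarith [abs_nonneg C, abs_nonneg (z.1 - xbar)]
        · simp only
          rw [hz2, ← hy1bar, dist_eq_norm]
          refine hzC.trans ?_
          rw [Real.norm_eq_abs]
          nlinarith [le_abs_self C, abs_nonneg (z.1 - xbar)]
      refine h3.trans ?_
      rw [mul_assoc]
      exact mul_le_mul_of_nonneg_left h2 (by positivity)
end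
end
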